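/- arXiv:math/0202012 — 3 statements merged into one kernel-verified Lean document; each statement's English description precedes it below -/
import Mathlib

section
/- Let A be a one-dimensional noetherian local commutative ring and let f ∈ A be a non-zerodivisor. Then length_A(A/(f)) = Σ_p length_{A_p}(A_p) · length_A(A/(p + (f))), where the sum runs over the minimal prime ideals p of A, A_p denotes the localization of A at p, and all lengths occurring are finite. -/
/-- The length of a module, i.e. the height of the top element of its lattice of submodules. -/
noncomputable def moduleLength (R : Type*) [Ring R] (M : Type*) [AddCommGroup M] [Module R M] :
    ℕ∞ :=
  Order.height (⊤ : Submodule R M)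

open Function

lemma aux_exact {A M N P : Type*} [CommRing A] [AddCommGroup M] [Module A M] [AddCommGroup N] [Module A N]
    [AddCommGroup P] [Module A P] (u : M →ₗ[A] N) (v : N →ₗ[A] P) (h : Exact u v) :
    Module.length A N = Module.length A (LinearMap.range u) + Module.length A (LinearMap.range v) := by
  refine Module.length_eq_add_of_exact (LinearMap.range u).subtype v.rangeRestrict
    (Submodule.subtype_injective _) v.surjective_rangeRestrict ?_
  rw [LinearMap.exact_iff, LinearMap.ker_rangeRestrict, Submodule.range_subtype]
  exact LinearMap.exact_iff.mp h

lemma aux_snake {A M₁ M₂ M₃ : Type*} [CommRing A] [AddCommGroup M₁] [Module A M₁]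
    [AddCommGroup M₂] [Module A M₂] [AddCommGroup M₃] [Module A M₃] (f : A)
    (u : M₁ →ₗ[A] M₂) (v : M₂ →ₗ[A] M₃) (hu : Injective u) (hv : Surjective v) (h : Exact u v) :
    Module.length A (LinearMap.ker (LinearMap.lsmul A M₁ f)) +
      Module.length A (LinearMap.ker (LinearMap.lsmul A M₃ f)) +
      Module.length A (M₂ ⧸ LinearMap.range (LinearMap.lsmul A M₂ f)) =
    Module.length A (LinearMap.ker (LinearMap.lsmul A M₂ f)) +
      Module.length A (M₁ ⧸ LinearMap.range (LinearMap.lsmul A M₁ f)) +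
      Module.length A (M₃ ⧸ LinearMap.range (LinearMap.lsmul A M₃ f)) := by
  have h1 : u.comp (LinearMap.lsmul A M₁ f) = (LinearMap.lsmul A M₂ f).comp u := by ext; simp
  have h2 : v.comp (LinearMap.lsmul A M₂ f) = (LinearMap.lsmul A M₃ f).comp v := by ext; simp
  let i₁ := LinearMap.lsmul A M₁ f
  let i₂ := LinearMap.lsmul A M₂ f
  let i₃ := LinearMap.lsmul A M₃ f
  have e1 : ∀ x ∈ LinearMap.ker i₁, u x ∈ LinearMap.ker i₂ := fun x hx => by
    have := congr($h1 x)
    simp only [LinearMap.comp_apply] at this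
    rw [LinearMap.mem_ker] at hx ⊢
    rw [← this, hx, map_zero]
  have e2 : ∀ x ∈ LinearMap.ker i₂, v x ∈ LinearMap.ker i₃ := fun x hx => by
    have := congr($h2 x)
    simp only [LinearMap.comp_apply] at this
    rw [LinearMap.mem_ker] at hx ⊢
    rw [← this, hx, map_zero]
  let k₁ := u.restrict e1
  let k₂ := v.restrict e2
  have r1 : LinearMap.range i₁ ≤ (LinearMap.range i₂).comap u := by
    rintro _ ⟨x, rfl⟩
    exact ⟨u x, congr($h1 x).symm⟩
  have r2 : LinearMap.range i₂ ≤ (LinearMap.range i₃).comap v := by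
    rintro _ ⟨x, rfl⟩
    exact ⟨v x, congr($h2 x).symm⟩
  let c₁ := Submodule.mapQ _ _ u r1
  let c₂ := Submodule.mapQ _ _ v r2
  have hk₁ : Injective k₁ := fun x y hxy => Subtype.ext (hu congr(($hxy).1))
  have hc₂ : Surjective c₂ := by
    intro y
    obtain ⟨y, rfl⟩ := Submodule.mkQ_surjective _ y
    obtain ⟨x, rfl⟩ := hv y
    exact ⟨Submodule.Quotient.mk x, rfl⟩
  have ek : Exact k₁ k₂ := by
    intro y
    constructor
    · intro hy
      obtain ⟨x, hx⟩ := (h y.1).1 congr(($hy).1)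
      refine ⟨⟨x, ?_⟩, Subtype.ext hx⟩
      apply hu
      have := congr($h1 x)
      simp only [LinearMap.comp_apply] at this
      rw [this, hx, map_zero]
      exact y.2
    · rintro ⟨x, rfl⟩
      exact Subtype.ext ((h _).2 ⟨x.1, rfl⟩)
  have ec : Exact c₁ c₂ := by
    intro y
    obtain ⟨y, rfl⟩ := Submodule.mkQ_surjective _ y
    constructor
    · intro hy
      obtain ⟨z, hz⟩ := (Submodule.Quotient.mk_eq_zero _).1 (show Submodule.Quotient.mk (v y) = 0 from hy)
      obtain ⟨z, rfl⟩ := hv z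
      have := congr($h2 z)
      simp only [LinearMap.comp_apply] at this
      obtain ⟨x, hx⟩ := (h (y - i₂ z)).1 (by rw [map_sub, this, hz, sub_self])
      refine ⟨Submodule.Quotient.mk x, ?_⟩
      change Submodule.Quotient.mk (u x) = Submodule.Quotient.mk y
      rw [hx, Submodule.Quotient.eq]
      exact ⟨-z, by rw [map_neg]; abel⟩
    · rintro ⟨x, hx⟩
      obtain ⟨x, rfl⟩ := Submodule.mkQ_surjective _ x
      rw [← hx]
      change Submodule.Quotient.mk (v (u x)) = 0
      rw [(h _).2 ⟨x, rfl⟩]; rfl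
  let d := SnakeLemma.δ' i₁ i₂ i₃ u v h u v h h1 h2 (LinearMap.ker i₃).subtype
    (LinearMap.exact_subtype_ker_map i₃) (LinearMap.range i₁).mkQ (LinearMap.exact_map_mkQ_range i₁) hv hu
  have d1 : Exact k₂ d := SnakeLemma.exact_δ'_right i₁ i₂ i₃ u v h u v h h1 h2
    (LinearMap.ker i₂).subtype (LinearMap.exact_subtype_ker_map i₂) _ _ _ _ hv hu k₂ rfl
    (Submodule.subtype_injective _)
  have d2 : Exact d c₁ := SnakeLemma.exact_δ'_left i₁ i₂ i₃ u v h u v h h1 h2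
    _ _ _ _ (LinearMap.range i₂).mkQ (LinearMap.exact_map_mkQ_range i₂) hv hu c₁ rfl
    (Submodule.mkQ_surjective _)
  have E2 := aux_exact _ _ ek
  have E3 := aux_exact _ _ d1
  have E4 := aux_exact _ _ d2
  have E5 := aux_exact _ _ ec
  rw [← (LinearEquiv.ofInjective k₁ hk₁).length_eq] at E2
  rw [LinearMap.range_eq_top.2 hc₂, Module.length_top] at E5
  rw [E2, E3, E4, E5]
  abel

open scoped Classical in
/-- the sum -/
noncomputable def auxS (A : Type*) [CommRing A] (f : A) (M : Type*) [AddCommGroup M] [Module A M] : ℕ∞ :=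
  ∑ᶠ p : minimalPrimes A,
        (haveI : p.1.IsPrime := p.2.1.1
         Module.length (Localization.AtPrime p.1) (LocalizedModule p.1.primeCompl M) *
           Module.length A (A ⧸ (p.1 + Ideal.span {f})))

/-- the claim -/
def auxP (A : Type*) [CommRing A] (f : A) (M : Type*) [AddCommGroup M] [Module A M] : Prop :=
  Module.length A (LinearMap.ker (LinearMap.lsmul A M f)) ≠ ⊤ ∧
  Module.length A (M ⧸ LinearMap.range (LinearMap.lsmul A M f)) =
   Module.length A (LinearMap.ker (LinearMap.lsmul A M f)) + auxS A f M

lemma auxP_exact {A M₁ M₂ M₃ : Type*} [CommRing A] [IsNoetherianRing A] [AddCommGroup M₁] [Module A M₁]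
    [AddCommGroup M₂] [Module A M₂] [AddCommGroup M₃] [Module A M₃] (f : A)
    (u : M₁ →ₗ[A] M₂) (v : M₂ →ₗ[A] M₃) (hu : Injective u) (hv : Surjective v) (h : Exact u v)
    (P₁ : auxP A f M₁) (P₃ : auxP A f M₃) : auxP A f M₂ := by
  have hS : auxS A f M₂ = auxS A f M₁ + auxS A f M₃ := by
    have : Finite (minimalPrimes A) := (minimalPrimes.finite_of_isNoetherianRing A).to_subtype
    unfold auxS
    rw [← finsum_add_distrib (Set.toFinite _) (Set.toFinite _)]
    congr 1
    ext1 p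
    haveI : p.1.IsPrime := p.2.1.1
    rw [← add_mul]
    congr 1
    exact Module.length_eq_add_of_exact (LocalizedModule.map p.1.primeCompl u)
      (LocalizedModule.map p.1.primeCompl v) (LocalizedModule.map_injective _ u hu)
      (LocalizedModule.map_surjective _ v hv) (LocalizedModule.map_exact _ u v h)
  have sn := aux_snake f u v hu hv h
  obtain ⟨a1, b1⟩ := P₁
  obtain ⟨a3, b3⟩ := P₃
  have e1 : ∀ x ∈ LinearMap.ker (LinearMap.lsmul A M₁ f), u x ∈ LinearMap.ker (LinearMap.lsmul A M₂ f) := fun x hx => by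
    simp at hx ⊢; rw [← map_smul, hx, map_zero]
  have e2 : ∀ x ∈ LinearMap.ker (LinearMap.lsmul A M₂ f), v x ∈ LinearMap.ker (LinearMap.lsmul A M₃ f) := fun x hx => by
    simp at hx ⊢; rw [← map_smul, hx, map_zero]
  have ek : Exact (u.restrict e1) (v.restrict e2) := by
    intro y
    constructor
    · intro hy
      obtain ⟨x, hx⟩ := (h y.1).1 congr(($hy).1)
      refine ⟨⟨x, ?_⟩, Subtype.ext hx⟩
      have hy : f • y.1 = 0 := y.2
      change f • x = 0
      apply hu
      rw [map_smul, hx, map_zero, hy]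
    · rintro ⟨x, rfl⟩
      exact Subtype.ext ((h _).2 ⟨x.1, rfl⟩)
  have hK := aux_exact _ _ ek
  constructor
  · rw [hK]
    refine WithTop.add_ne_top.2 ⟨?_, ?_⟩
    · exact ne_top_of_le_ne_top a1 (Module.length_le_of_surjective _ (LinearMap.surjective_rangeRestrict _))
    · exact ne_top_of_le_ne_top a3 (Module.length_le_of_injective _ (Submodule.subtype_injective _))
  · rw [hS]
    rw [b1, b3] at sn
    have := ENat.add_eq_top.not.2 (not_or.2 ⟨a1, a3⟩)
    apply ENat.add_right_injective_of_ne_top this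
    simp only
    rw [sn]
    abel

lemma auxP_subsingleton {A M : Type*} [CommRing A] [AddCommGroup M] [Module A M] [Subsingleton M] (f : A) :
    auxP A f M := by
  unfold auxP auxS
  simp [Module.length_eq_zero]

lemma aux_len_one {A : Type*} [CommRing A] (q : Ideal A) [q.IsPrime] :
    Module.length (Localization.AtPrime q) (LocalizedModule q.primeCompl (A ⧸ q)) = 1 := by
  rw [Module.length_eq_one_iff, isSimpleModule_iff_toSpanSingleton_surjective]
  constructor
  · have : (⟨q, inferInstance⟩ : PrimeSpectrum A) ∈ Module.support A (A ⧸ q) := by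
      rw [Module.mem_support_iff_of_finite, Ideal.annihilator_quotient]
    exact this
  · intro x hx y
    induction x using LocalizedModule.induction_on with
    | h m s =>
    induction y using LocalizedModule.induction_on with
    | h n t =>
    obtain ⟨a, rfl⟩ := Ideal.Quotient.mk_surjective m
    obtain ⟨b, rfl⟩ := Ideal.Quotient.mk_surjective n
    have ha : a ∉ q := by
      intro ha
      rw [Ideal.Quotient.eq_zero_iff_mem.2 ha, LocalizedModule.zero_mk] at hx
      exact hx rfl
    refine ⟨Localization.mk (b * s) (⟨a, ha⟩ * t), ?_⟩
    rw [LinearMap.toSpanSingleton_apply, LocalizedModule.mk_smul_mk, LocalizedModule.mk_eq]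
    refine ⟨1, ?_⟩
    simp only [one_smul, Submonoid.smul_def, Submonoid.coe_mul]
    simp only [Algebra.smul_def, Ideal.Quotient.algebraMap_eq, map_mul]
    ring

lemma aux_finite {A : Type*} [CommRing A] (f : A) (M : Type*) [AddCommGroup M] [Module A M] 
    (hM : Module.length A M ≠ ⊤) : Module.length A (M ⧸ LinearMap.range (LinearMap.lsmul A M f)) =
   Module.length A (LinearMap.ker (LinearMap.lsmul A M f)) := by
  have h1 := Module.length_eq_add_of_exact (LinearMap.range (LinearMap.lsmul A M f)).subtype
     (LinearMap.range (LinearMap.lsmul A M f)).mkQ (Submodule.subtype_injective _)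
     (Submodule.mkQ_surjective _) (LinearMap.exact_subtype_mkQ _)
  have h2 := aux_exact (LinearMap.ker (LinearMap.lsmul A M f)).subtype
     _ (LinearMap.exact_subtype_ker_map (LinearMap.lsmul A M f))
  rw [Submodule.range_subtype, add_comm] at h2
  rw [h1] at hM
  rw [h1] at h2
  exact ENat.add_right_injective_of_ne_top (WithTop.add_ne_top.1 hM).1 h2

lemma aux_zero {A : Type*} [CommRing A] (p q : Ideal A) [p.IsPrime] (h : ¬ q ≤ p) :
    Module.length (Localization.AtPrime p) (LocalizedModule p.primeCompl (A ⧸ q)) = 0 := by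
  rw [Module.length_eq_zero_iff]
  have : (⟨p, inferInstance⟩ : PrimeSpectrum A) ∉ Module.support A (A ⧸ q) := by
    rwa [Module.mem_support_iff_of_finite, Ideal.annihilator_quotient]
  rwa [Module.notMem_support_iff] at this

lemma auxP_prime {A : Type*} [CommRing A] [IsNoetherianRing A] [IsLocalRing A]
    (hdim : ringKrullDim A = 1)
    (f : A) (hf : f ∈ nonZeroDivisors A) (q : Ideal A) [hq : q.IsPrime] : auxP A f (A ⧸ q) := by
  by_cases hm : q ∈ minimalPrimes A
  · have hfq : f ∉ q := fun h => notMem_nonZeroDivisors_of_mem_mem_minimalPrimes h hm hf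
    have hk : LinearMap.ker (LinearMap.lsmul A (A ⧸ q) f) = ⊥ := by
      rw [LinearMap.ker_eq_bot']
      intro m hm
      obtain ⟨a, rfl⟩ := Ideal.Quotient.mk_surjective m
      change Ideal.Quotient.mk q (f * a) = 0 at hm
      rw [Ideal.Quotient.eq_zero_iff_mem] at hm ⊢
      exact (hq.mem_or_mem hm).resolve_left hfq
    have hS : auxS A f (A ⧸ q) = Module.length A (A ⧸ (q + Ideal.span {f})) := by
      unfold auxS
      rw [finsum_eq_single _ ⟨q, hm⟩]
      · rw [aux_len_one, one_mul]
      · intro p hp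
        haveI : p.1.IsPrime := p.2.1.1
        rw [aux_zero, zero_mul]
        intro hqp
        exact hp (Subtype.ext (le_antisymm (p.2.2 ⟨hq, bot_le⟩ hqp) hqp))
    rw [auxP, hk, hS]
    refine ⟨by simp [Module.length_eq_zero], ?_⟩
    rw [Module.length_bot, zero_add]
    let φ : A →ₗ[A] (A ⧸ q) ⧸ LinearMap.range (LinearMap.lsmul A (A ⧸ q) f) :=
      (Submodule.mkQ _).comp (Submodule.mkQ q)
    have hφ : LinearMap.ker φ = q + Ideal.span {f} := by
      ext x
      rw [LinearMap.ker_comp, Submodule.ker_mkQ, Submodule.mem_comap]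
      constructor
      · rintro ⟨y, hy⟩
        obtain ⟨y, rfl⟩ := Ideal.Quotient.mk_surjective y
        change Ideal.Quotient.mk q (f * y) = Ideal.Quotient.mk q x at hy
        rw [Ideal.Quotient.eq] at hy
        rw [show x = -(f * y - x) + y * f by ring]
        exact add_mem (Ideal.mem_sup_left (neg_mem hy))
          (Ideal.mem_sup_right (Ideal.mul_mem_left _ _ (Ideal.mem_span_singleton_self f)))
      · intro hx
        obtain ⟨a, ha, b, hb, rfl⟩ := Submodule.mem_sup.1 hx
        obtain ⟨c, rfl⟩ := Ideal.mem_span_singleton.1 hb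
        refine ⟨Ideal.Quotient.mk q c, ?_⟩
        change Ideal.Quotient.mk q (f * c) = Ideal.Quotient.mk q (a + f * c)
        rw [map_add, Ideal.Quotient.eq_zero_iff_mem.2 ha, zero_add]
    have hs : Surjective φ := (Submodule.mkQ_surjective _).comp (Submodule.mkQ_surjective _)
    rw [← hφ]
    exact (φ.quotKerEquivOfSurjective hs).symm.length_eq
  · have hmax : q.IsMaximal := by
      haveI : Ring.KrullDimLE 1 A := (Ring.krullDimLE_iff).2 hdim.le
      exact (Ring.krullDimLE_one_iff.1 this q hq).resolve_left hm
    have hs : IsSimpleModule A (A ⧸ q) := by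
      rw [isSimpleModule_iff_isCoatom]; exact hmax.out
    have hl : Module.length A (A ⧸ q) ≠ ⊤ := by
      rw [Module.length_eq_one]; simp
    have hS : auxS A f (A ⧸ q) = 0 := by
      unfold auxS
      refine finsum_eq_zero_of_forall_eq_zero fun p => ?_
      haveI : p.1.IsPrime := p.2.1.1
      rw [aux_zero, zero_mul]
      intro hqp
      have : p.1 = q := le_antisymm (p.2.2 ⟨hq, bot_le⟩ hqp) hqp
      exact hm (this ▸ p.2)
    rw [auxP, hS, add_zero, aux_finite _ _ hl]
    exact ⟨ne_top_of_le_ne_top hl (Module.length_le_of_injective _ (Submodule.subtype_injective _)), rfl⟩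

lemma auxP_all {A : Type*} [CommRing A] [IsNoetherianRing A] [IsLocalRing A]
    (hdim : ringKrullDim A = 1)
    (f : A) (hf : f ∈ nonZeroDivisors A) (M : Type*) [AddCommGroup M] [Module A M]
    [hM : Module.Finite A M] : auxP A f M := by
  induction hM using
    IsNoetherianRing.induction_on_isQuotientEquivQuotientPrime A with
  | subsingleton N => exact auxP_subsingleton f
  | quotient N p e =>
    have := p.2
    refine auxP_exact f e.symm.toLinearMap (0 : N →ₗ[A] PUnit) e.symm.injective
      (fun x => ⟨0, Subsingleton.elim _ _⟩) ?_ (auxP_prime hdim f hf p.1) (auxP_subsingleton f)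
    intro y
    simpa using ⟨e y, e.symm_apply_apply y⟩
  | exact N₁ N₂ N₃ u v hu hv huv h₁ h₃ => exact auxP_exact f u v hu hv huv h₁ h₃

/-- **Deligne's lemma** (Lemma 3.2 of Voevodsky's "Cancellation theorem", local algebraic form).
Let `A` be a one-dimensional noetherian local commutative ring and `f ∈ A` a non-zerodivisor.
Then `length_A (A/(f)) = Σ_p length_{A_p}(A_p) · length_A (A/(p + (f)))`, the sum running over
the minimal primes `p` of `A`, and all lengths occurring are finite. -/
theorem length_quotient_span_eq_sum_over_minimalPrimes
    (A : Type*) [CommRing A] [IsNoetherianRing A] [IsLocalRing A]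
    (hdim : ringKrullDim A = 1)
    (f : A) (hf : f ∈ nonZeroDivisors A) :
    moduleLength A (A ⧸ Ideal.span {f}) ≠ ⊤ ∧
    (∀ p : minimalPrimes A,
      letI : p.1.IsPrime := p.2.1.1
      moduleLength (Localization.AtPrime p.1) (Localization.AtPrime p.1) ≠ ⊤ ∧
        moduleLength A (A ⧸ (p.1 + Ideal.span {f})) ≠ ⊤) ∧
    moduleLength A (A ⧸ Ideal.span {f}) =
      ∑ᶠ p : minimalPrimes A,
        (letI : p.1.IsPrime := p.2.1.1
         moduleLength (Localization.AtPrime p.1) (Localization.AtPrime p.1) *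
           moduleLength A (A ⧸ (p.1 + Ideal.span {f}))) := by
  simp only [moduleLength, ← Module.length_eq_height]
  have hfin : Module.length A (A ⧸ Ideal.span {f}) ≠ ⊤ := by
    haveI : Ring.KrullDimLE 1 A := (Ring.krullDimLE_iff).2 hdim.le
    exact Ring.ord_ne_top hf
  refine ⟨hfin, fun p => ⟨?_, ?_⟩, ?_⟩
  · haveI : p.1.IsPrime := p.2.1.1
    haveI : Ring.KrullDimLE 0 (Localization.AtPrime p.1) := by
      rw [Ring.krullDimLE_iff, IsLocalization.AtPrime.ringKrullDim_eq_height p.1,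
        Ideal.height_eq_zero_iff.2 p.2]
      rfl
    haveI : IsArtinianRing (Localization.AtPrime p.1) := 
      IsNoetherianRing.isArtinianRing_of_krullDimLE_zero
    exact Module.length_ne_top
  · refine ne_top_of_le_ne_top hfin (Module.length_le_of_surjective
      (Submodule.factor (le_sup_right : Ideal.span {f} ≤ p.1 ⊔ Ideal.span {f})) 
      (Submodule.factor_surjective _))
  · have h := (auxP_all hdim f hf A).2
    have hr : LinearMap.range (LinearMap.lsmul A A f) = Ideal.span {f} := by
      ext x
      simp only [LinearMap.mem_range, LinearMap.lsmul_apply, smul_eq_mul, Ideal.mem_span_singleton,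
        dvd_def, eq_comm]
    have hk : LinearMap.ker (LinearMap.lsmul A A f) = ⊥ := by
      rw [LinearMap.ker_eq_bot']
      intro m hm
      exact (mem_nonZeroDivisors_iff.1 hf).1 m hm
    rw [hr, hk, Module.length_bot, zero_add] at h
    exact h
end

section
/- Let A be a noetherian local domain of Krull dimension 1 with fraction field K, let M be a finitely generated A-module, let r = dim_K(M ⊗_A K) be its generic rank, and let g ∈ A be a nonzero element. Then length_A(M/gM) − length_A({m ∈ M : g·m = 0}) = r · length_A(A/gA), all lengths being finite. -/
open TensorProduct

theorem moduleLength_eq (R : Type*) [Ring R] (M : Type*) [AddCommGroup M] [Module R M] :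
    moduleLength R M = Module.length R M := (Module.length_eq_height R M).symm

/-- componentwise reduction `A^n → (A/a)^n` -/
noncomputable def redMap {A : Type*} [CommRing A] (a : A) (n : ℕ) :
    (Fin n → A) →ₗ[A] (Fin n → A ⧸ Ideal.span {a}) :=
  LinearMap.pi fun i => (Ideal.span {a}).mkQ ∘ₗ LinearMap.proj i

theorem redMap_surj {A : Type*} [CommRing A] (a : A) (n : ℕ) :
    Function.Surjective (redMap a n) := by
  intro w
  choose v hv using fun i => (Ideal.span {a}).mkQ_surjective (w i)
  exact ⟨v, funext hv⟩

theorem mem_ker_redMap {A : Type*} [CommRing A] (a : A) (n : ℕ) (v : Fin n → A) :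
    v ∈ LinearMap.ker (redMap a n) ↔ ∃ w : Fin n → A, v = a • w := by
  have h : v ∈ LinearMap.ker (redMap a n) ↔ ∀ i, a ∣ v i := by
    rw [LinearMap.mem_ker, funext_iff]
    refine forall_congr' fun i => ?_
    change (Ideal.span {a}).mkQ (v i) = 0 ↔ _
    rw [Submodule.mkQ_apply, Submodule.Quotient.mk_eq_zero, Ideal.mem_span_singleton]
  rw [h]
  constructor
  · intro h
    choose w hw using h
    exact ⟨w, funext fun i => by simp [hw i]⟩
  · rintro ⟨w, rfl⟩ i
    exact ⟨w i, by simp⟩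

theorem length_torsion_ne_top {A : Type*} [CommRing A] [IsDomain A] [IsNoetherianRing A]
    [Ring.KrullDimLE 1 A] (M : Type*) [AddCommGroup M] [Module A M] [Module.Finite A M]
    (hM : Module.IsTorsion A M) : Module.length A M ≠ ⊤ := by
  obtain ⟨a, ha, ha0⟩ := Submodule.annihilator_top_inter_nonZeroDivisors hM
  have ham : ∀ m : M, a • m = 0 := fun m =>
    Submodule.mem_annihilator.1 ha m Submodule.mem_top
  obtain ⟨n, s, hs⟩ := Module.Finite.exists_fin' A M
  have hle : LinearMap.ker (redMap a n) ≤ LinearMap.ker s := by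
    intro v hv
    obtain ⟨w, rfl⟩ := (mem_ker_redMap a n v).1 hv
    simp [ham]
  have e := (redMap a n).quotKerEquivOfSurjective (redMap_surj a n)
  have h1 : Module.length A M ≤ Module.length A ((Fin n → A) ⧸ LinearMap.ker (redMap a n)) := by
    refine Module.length_le_of_surjective ((LinearMap.ker (redMap a n)).liftQ s hle) ?_
    intro m
    obtain ⟨v, rfl⟩ := hs m
    exact ⟨Submodule.Quotient.mk v, rfl⟩
  rw [e.length_eq] at h1
  refine ne_top_of_le_ne_top ?_ h1
  have := Module.length_ne_top_iff.2 (isFiniteLength_quotient_span_singleton A ha0)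
  simp only [Module.length_pi_of_fintype, Finset.sum_const]
  generalize Module.length A (A ⧸ Ideal.span {a}) = l at *
  lift l to ℕ using this
  simp only [Finset.card_univ, Fintype.card_fin, nsmul_eq_mul]
  exact_mod_cast ENat.natCast_ne_top (n * l)

theorem exists_free_sub {A : Type*} [CommRing A] [IsDomain A]
    (M : Type*) [AddCommGroup M] [Module A M] [Module.Finite A M] :
    ∃ φ : (Fin (Module.finrank A M) → A) →ₗ[A] M, Function.Injective φ ∧
      Module.IsTorsion A (M ⧸ LinearMap.range φ) := by
  obtain ⟨v, hv⟩ := exists_linearIndependent_of_le_finrank (R := A) (M := M) le_rfl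
  refine ⟨Fintype.linearCombination A v, ?_, ?_⟩
  · exact hv.fintypeLinearCombination_injective
  · rw [← Module.finrank_eq_zero_iff_isTorsion]
    have h1 := Submodule.finrank_quotient_add_finrank
      (LinearMap.range (Fintype.linearCombination A v))
    rw [LinearMap.finrank_range_of_inj (hv.fintypeLinearCombination_injective)] at h1
    simp at h1
    exact h1

theorem length_quot_of_le {A M : Type*} [CommRing A] [AddCommGroup M] [Module A M]
    (N P : Submodule A M) (h : N ≤ P) :
    Module.length A (M ⧸ N) = Module.length A (P.map N.mkQ) + Module.length A (M ⧸ P) := by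
  rw [← (Submodule.quotientQuotientEquivQuotient N P h).length_eq]
  exact Module.length_eq_add_of_exact (P.map N.mkQ).subtype (P.map N.mkQ).mkQ
    (Submodule.subtype_injective _) (Submodule.mkQ_surjective _) (LinearMap.exact_subtype_mkQ _)

theorem length_ker_add_range {A M N : Type*} [CommRing A] [AddCommGroup M] [Module A M]
    [AddCommGroup N] [Module A N] (h : M →ₗ[A] N) :
    Module.length A M = Module.length A (LinearMap.ker h) + Module.length A (LinearMap.range h) := by
  rw [← h.quotKerEquivRange.length_eq]
  exact Module.length_eq_add_of_exact (LinearMap.ker h).subtype (LinearMap.ker h).mkQ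
    (Submodule.subtype_injective _) (Submodule.mkQ_surjective _) (LinearMap.exact_subtype_mkQ _)

theorem key {A M : Type*} [CommRing A] [IsDomain A] [AddCommGroup M] [Module A M] {n : ℕ}
    (φ : (Fin n → A) →ₗ[A] M) (hφ : Function.Injective φ) (g : A) (hg : g ≠ 0) :
    ∃ x : ℕ∞, Module.length A (M ⧸ LinearMap.range φ) =
        Module.length A (LinearMap.ker (LinearMap.lsmul A M g)) + x ∧
      n * Module.length A (A ⧸ Ideal.span {g}) + Module.length A (M ⧸ LinearMap.range φ) =
        x + Module.length A (M ⧸ LinearMap.range (LinearMap.lsmul A M g)) := by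
  set f := LinearMap.lsmul A M g with hf
  have hfa : ∀ m, f m = g • m := fun m => rfl
  set F := LinearMap.range φ with hF
  set G := F.map f with hG
  have hGF : G ≤ F := by
    rintro _ ⟨m, hm, rfl⟩
    exact F.smul_mem g hm
  have hGf : G ≤ LinearMap.range f := LinearMap.map_le_range
  let h : (M ⧸ F) →ₗ[A] (M ⧸ G) := F.mapQ G f (Submodule.le_comap_map f F)
  have hrange : LinearMap.range h = (LinearMap.range f).map G.mkQ := by
    rw [← LinearMap.range_comp, ← Submodule.mapQ_mkQ F G f,
      LinearMap.range_comp_of_range_eq_top _ (Submodule.range_mkQ F)]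
  have hker : Module.length A (LinearMap.ker h) = Module.length A (LinearMap.ker f) := by
    let k : LinearMap.ker f →ₗ[A] M ⧸ F := F.mkQ ∘ₗ (LinearMap.ker f).subtype
    have hk : Function.Injective k := by
      rw [← LinearMap.ker_eq_bot, LinearMap.ker_eq_bot']
      rintro ⟨m, hm⟩ h0
      have h0' : m ∈ F := (Submodule.Quotient.mk_eq_zero F).1 h0
      obtain ⟨v, rfl⟩ := h0'
      have : φ (g • v) = φ 0 := by rw [map_smul, map_zero]; exact hm
      have := hφ this
      have : v = 0 := (smul_eq_zero.1 this).resolve_left hg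
      subst this
      simp
    have hr : LinearMap.range k = LinearMap.ker h := by
      ext y
      constructor
      · rintro ⟨⟨m, hm⟩, rfl⟩
        change G.mkQ (f m) = 0
        rw [LinearMap.mem_ker.1 hm, map_zero]
      · intro hy
        obtain ⟨m, rfl⟩ := F.mkQ_surjective y
        have hy' : f m ∈ G := (Submodule.Quotient.mk_eq_zero G).1 hy
        obtain ⟨p, hp, hpm⟩ := hy'
        refine ⟨⟨m - p, by rw [LinearMap.mem_ker, map_sub, hpm, sub_self]⟩, ?_⟩
        change F.mkQ (m - p) = _
        rw [map_sub, sub_eq_self]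
        exact (Submodule.Quotient.mk_eq_zero F).2 hp
    rw [← hr]
    exact (LinearEquiv.ofInjective k hk).length_eq.symm
  refine ⟨Module.length A (LinearMap.range h), ?_, ?_⟩
  · rw [← hker]; exact length_ker_add_range h
  · rw [hrange, ← length_quot_of_le G _ hGf, length_quot_of_le G F hGF]
    congr 1
    have hk : LinearMap.ker (G.mkQ ∘ₗ φ) = LinearMap.ker (redMap g n) := by
      ext v
      rw [mem_ker_redMap, LinearMap.mem_ker, LinearMap.comp_apply, Submodule.mkQ_apply,
        Submodule.Quotient.mk_eq_zero]
      constructor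
      · rintro ⟨_, ⟨w, rfl⟩, hw⟩
        exact ⟨w, hφ (by rw [map_smul]; exact hw.symm)⟩
      · rintro ⟨w, rfl⟩
        exact ⟨φ w, ⟨w, rfl⟩, by rw [map_smul, hfa]⟩
    have e1 := (G.mkQ ∘ₗ φ).quotKerEquivRange.length_eq
    have e2 := ((redMap g n).quotKerEquivOfSurjective (redMap_surj g n)).length_eq
    rw [hF, ← LinearMap.range_comp, ← e1, hk, e2]
    simp [Module.length_pi_of_fintype]

/-- Let `A` be a noetherian local domain of Krull dimension 1 with fraction field `K`, `M` a
finitely generated `A`-module of generic rank `r = dim_K (M ⊗_A K)`, and `g ∈ A` nonzero. Then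
`length_A (M/gM) - length_A (ker (g : M → M)) = r · length_A (A/gA)`, all lengths being finite. -/
theorem eulerChar_smul_eq_genericRank_mul_length
    (A : Type*) [CommRing A] [IsDomain A] [IsNoetherianRing A] [IsLocalRing A]
    (hdim : ringKrullDim A = 1)
    (M : Type*) [AddCommGroup M] [Module A M] [Module.Finite A M]
    (r : ℕ) (hr : r = Module.finrank (FractionRing A) (FractionRing A ⊗[A] M))
    (g : A) (hg : g ≠ 0) :
    moduleLength A (M ⧸ LinearMap.range (LinearMap.lsmul A M g)) ≠ ⊤ ∧
    moduleLength A (LinearMap.ker (LinearMap.lsmul A M g)) ≠ ⊤ ∧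
    moduleLength A (A ⧸ Ideal.span {g}) ≠ ⊤ ∧
    ((moduleLength A (M ⧸ LinearMap.range (LinearMap.lsmul A M g))).toNat : ℤ) -
        ((moduleLength A (LinearMap.ker (LinearMap.lsmul A M g))).toNat : ℤ) =
      (r : ℤ) * ((moduleLength A (A ⧸ Ideal.span {g})).toNat : ℤ) := by
  have : Ring.KrullDimLE 1 A := by
    rw [Ring.krullDimLE_iff, hdim]; rfl
  have hr' : r = Module.finrank A M := by
    rw [hr, IsFractionRing.finrank_right_eq A (FractionRing A),
      IsLocalizedModule.finrank_eq (nonZeroDivisors A)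
        (TensorProduct.mk A (FractionRing A) M 1) le_rfl]
  clear hr
  subst hr'
  obtain ⟨φ, hφ, ht⟩ := exists_free_sub (A := A) M
  have hfin := length_torsion_ne_top _ ht
  have hA : Module.length A (A ⧸ Ideal.span {g}) ≠ ⊤ := Module.length_ne_top_iff.2
    (isFiniteLength_quotient_span_singleton A (mem_nonZeroDivisors_of_ne_zero hg))
  obtain ⟨x, h1, h2⟩ := key φ hφ g hg
  simp only [moduleLength_eq]
  generalize Module.length A (M ⧸ LinearMap.range φ) = q at *
  generalize Module.length A (LinearMap.ker (LinearMap.lsmul A M g)) = k at *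
  generalize Module.length A (M ⧸ LinearMap.range (LinearMap.lsmul A M g)) = c at *
  generalize Module.length A (A ⧸ Ideal.span {g}) = l at *
  generalize Module.finrank A M = n at *
  lift q to ℕ using hfin
  lift l to ℕ using hA
  have hk : k ≠ ⊤ := by rintro rfl; simp at h1
  have hx : x ≠ ⊤ := by rintro rfl; simp at h1
  lift k to ℕ using hk
  lift x to ℕ using hx
  have hc : c ≠ ⊤ := by
    rintro rfl
    rw [add_top] at h2
    exact absurd h2 (by exact_mod_cast ENat.natCast_ne_top (n * l + q))
  lift c to ℕ using hc
  norm_cast at h1 h2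
  refine ⟨ENat.natCast_ne_top _, ENat.natCast_ne_top _, ENat.natCast_ne_top _, ?_⟩
  simp only [ENat.toNat_natCast]
  have h3 : ((n * l + q : ℕ) : ℤ) = ((x + c : ℕ) : ℤ) := by rw [h2]
  push_cast at h3
  rw [h1] at h3
  push_cast at h3
  linarith
end

section
/- Let A be a noetherian local domain of Krull dimension 1 with fraction field K and residue field k, let B be an integral domain containing A that is finitely generated as an A-module, with fraction field L, and let g ∈ A be a nonzero element. Then [L : K] · length_A(A/gA) = Σ_n [B/n : k] · length_{B_n}(B_n / g·B_n), where the sum runs over the (finitely many) maximal ideals n of B and B_n is the localization of B at n. -/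
open Module in
theorem aux_length_comp {R N₁ N₂ N₃ : Type*} [CommRing R] [AddCommGroup N₁] [AddCommGroup N₂]
    [AddCommGroup N₃] [Module R N₁] [Module R N₂] [Module R N₃]
    (f : N₁ →ₗ[R] N₂) (h : N₂ →ₗ[R] N₃) (hh : Function.Injective h) :
    Module.length R (N₃ ⧸ LinearMap.range (h ∘ₗ f)) =
      Module.length R (N₂ ⧸ LinearMap.range f) + Module.length R (N₃ ⧸ LinearMap.range h) := by
  have h1 : LinearMap.range f ≤ (LinearMap.range (h ∘ₗ f)).comap h := by
    rintro _ ⟨x, rfl⟩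
    exact ⟨x, rfl⟩
  have h2 : LinearMap.range (h ∘ₗ f) ≤ LinearMap.range h := LinearMap.range_comp_le_range f h
  refine Module.length_eq_add_of_exact (Submodule.mapQ _ _ h h1) (Submodule.factor h2) ?_ ?_ ?_
  · rw [injective_iff_map_eq_zero]
    intro x
    obtain ⟨x, rfl⟩ := Submodule.mkQ_surjective _ x
    simp only [Submodule.mkQ_apply, Submodule.mapQ_apply, Submodule.Quotient.mk_eq_zero]
    rintro ⟨y, hy⟩
    exact ⟨y, hh hy⟩
  · exact Submodule.factor_surjective h2
  · intro x
    obtain ⟨x, rfl⟩ := Submodule.mkQ_surjective _ x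
    constructor
    · intro hx
      have hx' : x ∈ LinearMap.range h := by simpa using hx
      obtain ⟨y, rfl⟩ := hx'
      exact ⟨Submodule.Quotient.mk y, by simp⟩
    · rintro ⟨y, hy⟩
      obtain ⟨y, rfl⟩ := Submodule.mkQ_surjective _ y
      rw [← hy]
      simp

theorem aux_finite_length {A M : Type*} [CommRing A] [IsDomain A] [IsNoetherianRing A]
    [Ring.KrullDimLE 1 A] [AddCommGroup M] [Module A M] [Module.Finite A M]
    (a : A) (ha : a ≠ 0) (h : ∀ m : M, a • m = 0) : IsArtinian A M := by
  have hfl := isFiniteLength_quotient_span_singleton A (mem_nonZeroDivisors_of_ne_zero ha)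
  rw [isFiniteLength_iff_isNoetherian_isArtinian] at hfl
  have : IsArtinian A (A ⧸ Ideal.span {a}) := hfl.2
  have : IsArtinianRing (A ⧸ Ideal.span {a}) := isArtinian_of_tower A this
  have ht : Module.IsTorsionBySet A M (Ideal.span {a} : Ideal A) := by
    rw [Module.isTorsionBySet_span_singleton_iff]
    exact fun m => h m
  letI := ht.module
  haveI : IsScalarTower A (A ⧸ Ideal.span {a}) M := ht.isScalarTower
  haveI : Module.Finite (A ⧸ Ideal.span {a}) M := Module.Finite.of_restrictScalars_finite A _ M
  exact isArtinian_of_surjective_algebraMap (R := A ⧸ Ideal.span {a})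
    (Ideal.Quotient.mk_surjective)

theorem aux_cancel {a b c : ℕ∞} (hc : c ≠ ⊤) (h : a + c = b + c) : a = b := by
  rw [add_comm a, add_comm b] at h
  exact le_antisymm (ENat.addLECancellable_of_ne_top hc h.le)
    (ENat.addLECancellable_of_ne_top hc h.ge)

theorem aux_rank {A B : Type*} [CommRing A] [IsDomain A] [IsNoetherianRing A]
    [Ring.KrullDimLE 1 A] [CommRing B] [IsDomain B] [Algebra A B] [Module.Finite A B]
    (hinj : Function.Injective (algebraMap A B)) (g : A) (hg : g ≠ 0) :
    Module.length A (B ⧸ Ideal.span {algebraMap A B g}) =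
      Module.finrank A B * Module.length A (A ⧸ Ideal.span {g}) := by
  obtain ⟨v, hv⟩ := exists_linearIndependent_of_le_finrank (R := A) (M := B) le_rfl
  let f : (Fin (Module.finrank A B) → A) →ₗ[A] B := Fintype.linearCombination A v
  have hf : Function.Injective f := hv.fintypeLinearCombination_injective
  have hfin : Module.finrank A (LinearMap.range f) = Module.finrank A B := by
    rw [LinearMap.finrank_range_of_inj hf]; simp
  have h0 : Module.finrank A (B ⧸ LinearMap.range f) = 0 := by
    have := Submodule.finrank_quotient_add_finrank (LinearMap.range f)
    omega
  have htor := Module.finrank_eq_zero_iff_isTorsion.mp h0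
  obtain ⟨a, ha, ha'⟩ := Submodule.annihilator_top_inter_nonZeroDivisors htor
  have hart : IsArtinian A (B ⧸ LinearMap.range f) := by
    refine aux_finite_length a (nonZeroDivisors.ne_zero ha') fun m => ?_
    exact (Submodule.mem_annihilator.mp ha) m trivial
  have hne : Module.length A (B ⧸ LinearMap.range f) ≠ ⊤ := Module.length_ne_top
  have hgB : algebraMap A B g ≠ 0 := by
    rwa [Ne, map_eq_zero_iff _ hinj]
  have e1 := aux_length_comp (LinearMap.lsmul A (Fin (Module.finrank A B) → A) g) f hf
  have e2 := aux_length_comp f (LinearMap.lsmul A B g) (by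
    intro x y hxy
    simp only [LinearMap.lsmul_apply, Algebra.smul_def] at hxy
    exact mul_left_cancel₀ hgB hxy)
  have e3 : f ∘ₗ (LinearMap.lsmul A (Fin (Module.finrank A B) → A) g) =
      (LinearMap.lsmul A B g) ∘ₗ f := by
    ext; simp
  rw [e3, e2, add_comm] at e1
  have e4 := aux_cancel hne e1
  have e5 : Module.length A (B ⧸ Ideal.span {algebraMap A B g}) =
      Module.length A (B ⧸ LinearMap.range (LinearMap.lsmul A B g)) := by
    have hr : LinearMap.range (LinearMap.lsmul A B g) =
        (Ideal.span {algebraMap A B g}).restrictScalars A := by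
      ext x
      simp only [LinearMap.mem_range, LinearMap.lsmul_apply, Submodule.restrictScalars_mem,
        Ideal.mem_span_singleton', Algebra.smul_def, mul_comm]
    rw [hr]
    exact (Submodule.Quotient.restrictScalarsEquiv A
      (Ideal.span {algebraMap A B g})).symm.length_eq
  let u : (Fin (Module.finrank A B) → A) →ₗ[A]
      (Fin (Module.finrank A B) → A ⧸ Ideal.span {g}) :=
    LinearMap.pi fun i => (Submodule.mkQ (Ideal.span {g})) ∘ₗ LinearMap.proj i
  have hu : Function.Surjective u := by
    intro y
    choose x hx using fun i => Submodule.mkQ_surjective (Ideal.span {g}) (y i)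
    exact ⟨x, funext hx⟩
  have hk : LinearMap.range (LinearMap.lsmul A (Fin (Module.finrank A B) → A) g) =
      LinearMap.ker u := by
    ext x
    have : x ∈ LinearMap.ker u ↔ ∀ i, x i ∈ Ideal.span {g} := by
      rw [LinearMap.mem_ker, funext_iff]
      refine forall_congr' fun i => ?_
      exact Submodule.Quotient.mk_eq_zero _
    rw [this]
    constructor
    · rintro ⟨y, rfl⟩ i
      exact Ideal.mem_span_singleton'.mpr ⟨y i, by simp [mul_comm]⟩
    · intro h
      choose y hy using fun i => Ideal.mem_span_singleton'.mp (h i)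
      exact ⟨y, funext fun i => by simp [← hy, mul_comm]⟩
  rw [e5, e4, hk, (u.quotKerEquivOfSurjective hu).length_eq, Module.length_pi_of_fintype]
  simp

theorem aux_crt {B : Type*} [CommRing B] [Finite (MaximalSpectrum B)] (I : Ideal B)
    [IsArtinianRing (B ⧸ I)] :
    Nonempty ((B ⧸ I) ≃ₗ[B] ((n : MaximalSpectrum B) → (Localization.AtPrime n.asIdeal ⧸
      I.map (algebraMap B (Localization.AtPrime n.asIdeal))))) := by
  let f (n : MaximalSpectrum B) : B →ₗ[B] (Localization.AtPrime n.asIdeal ⧸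
      I.map (algebraMap B (Localization.AtPrime n.asIdeal))) := Algebra.linearMap B _
  have hmem (n : MaximalSpectrum B) (x : B) : f n x = 0 ↔
      algebraMap B (Localization.AtPrime n.asIdeal) x ∈
        I.map (algebraMap B (Localization.AtPrime n.asIdeal)) := by
    rw [← Ideal.Quotient.eq_zero_iff_mem]; rfl
  have hsurj (n) : Function.Surjective (f n) := by
    have := IsArtinianRing.localization_surjective
      (Algebra.algebraMapSubmonoid (B ⧸ I) n.asIdeal.primeCompl)
      (Localization.AtPrime n.asIdeal ⧸ I.map (algebraMap B (Localization.AtPrime n.asIdeal)))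
    intro y
    obtain ⟨x, rfl⟩ := this y
    obtain ⟨x, rfl⟩ := Ideal.Quotient.mk_surjective x
    exact ⟨x, rfl⟩
  let J (n : MaximalSpectrum B) : Ideal B := LinearMap.ker (f n)
  have hJ (n p : MaximalSpectrum B) (h : J n ≤ p.asIdeal) : n = p := by
    by_contra hnp
    have : ¬ p.asIdeal ≤ n.asIdeal := fun hle =>
      hnp (MaximalSpectrum.ext (p.isMaximal.eq_of_le n.isMaximal.ne_top hle).symm)
    obtain ⟨s, hs, hsn⟩ := SetLike.not_le_iff_exists.mp this
    have hu : IsUnit (algebraMap B (Localization.AtPrime n.asIdeal) s) :=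
      IsLocalization.map_units _ (⟨s, hsn⟩ : n.asIdeal.primeCompl)
    obtain ⟨w, hw⟩ := hu.exists_right_inv
    obtain ⟨t, ht⟩ := hsurj n (Ideal.Quotient.mk _ w)
    have h1 : 1 - s * t ∈ J n := by
      change f n _ = 0
      have ht' : algebraMap B (Localization.AtPrime n.asIdeal ⧸
        I.map (algebraMap B (Localization.AtPrime n.asIdeal))) t = Ideal.Quotient.mk _ w := ht
      change algebraMap B (Localization.AtPrime n.asIdeal ⧸
        I.map (algebraMap B (Localization.AtPrime n.asIdeal))) (1 - s * t) = 0
      rw [map_sub, sub_eq_zero, map_mul, map_one, ht']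
      have := congrArg (Ideal.Quotient.mk
        (I.map (algebraMap B (Localization.AtPrime n.asIdeal)))) hw
      rw [map_mul] at this
      exact this.symm
    have : (1 : B) ∈ p.asIdeal := by
      have := p.asIdeal.add_mem (h h1) (p.asIdeal.mul_mem_right t hs)
      simpa using this
    exact p.isMaximal.ne_top ((Ideal.eq_top_iff_one _).mpr this)
  have hcop : Pairwise (Function.onFun IsCoprime J) := by
    intro n m hnm
    rw [Function.onFun, Ideal.isCoprime_iff_sup_eq]
    by_contra hne
    obtain ⟨p, hp, hle⟩ := Ideal.exists_le_maximal _ hne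
    have a1 := hJ n ⟨p, hp⟩ (le_sup_left.trans hle)
    have a2 := hJ m ⟨p, hp⟩ (le_sup_right.trans hle)
    exact hnm (a1.trans a2.symm)
  let F := LinearMap.pi f
  have hF : Function.Surjective F := by
    intro y
    choose x hx using fun n => hsurj n (y n)
    obtain ⟨r, hr⟩ := Ideal.pi_quotient_surjective hcop (fun n => Ideal.Quotient.mk _ (x n))
    refine ⟨r, funext fun n => ?_⟩
    have : r - x n ∈ J n := Ideal.Quotient.eq.mp (hr n)
    have : f n (r - x n) = 0 := this
    rw [map_sub, sub_eq_zero, hx] at this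
    exact this
  have hker : LinearMap.ker F = I := by
    ext x
    rw [LinearMap.mem_ker]
    constructor
    · intro hx
      refine Ideal.mem_of_localization_maximal fun P hP => ?_
      exact (hmem ⟨P, hP⟩ x).mp (congrFun hx ⟨P, hP⟩)
    · intro hx
      exact funext fun n => (hmem n x).mpr (Ideal.mem_map_of_mem _ hx)
  exact ⟨(Submodule.quotEquivOfEq _ _ hker.symm).trans (F.quotKerEquivOfSurjective hF)⟩

theorem aux_local {A B : Type*} [CommRing A] [IsLocalRing A] [CommRing B] [Algebra A B]
    [Module.Finite A B] (n : Ideal B) [n.IsMaximal]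
    (hle : IsLocalRing.maximalIdeal A ≤ n.comap (algebraMap A B))
    (J : Ideal (Localization.AtPrime n)) :
    Module.length A (Localization.AtPrime n ⧸ J) =
      (letI : Algebra (IsLocalRing.ResidueField A) (B ⧸ n) :=
          Ideal.Quotient.algebraQuotientOfLEComap hle;
         (Module.finrank (IsLocalRing.ResidueField A) (B ⧸ n) : ℕ∞)) *
        Module.length (Localization.AtPrime n) (Localization.AtPrime n ⧸ J) := by
  letI : Algebra (IsLocalRing.ResidueField A) (B ⧸ n) :=
    Ideal.Quotient.algebraQuotientOfLEComap hle
  have : IsLocalHom (algebraMap A (Localization.AtPrime n)) := by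
    refine ⟨fun a ha => ?_⟩
    by_contra hna
    have h1 : algebraMap A B a ∈ n := hle ((IsLocalRing.mem_maximalIdeal a).mpr hna)
    rw [IsScalarTower.algebraMap_apply A B (Localization.AtPrime n),
      IsLocalization.AtPrime.isUnit_to_map_iff _ n] at ha
    exact ha h1
  have : IsScalarTower A (IsLocalRing.ResidueField A) (B ⧸ n) :=
    IsScalarTower.of_algebraMap_eq fun x => rfl
  have : Module.Finite (IsLocalRing.ResidueField A) (B ⧸ n) :=
    Module.Finite.of_restrictScalars_finite A _ _
  rw [IsLocalRing.length_restrictScalars A (Localization.AtPrime n), mul_comm]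
  congr 1
  rw [← Module.length_eq_finrank,
    ← Module.length_eq_of_surjective (S := A) (R := IsLocalRing.ResidueField A)
      (M := B ⧸ n) IsLocalRing.residue_surjective,
    ← Module.length_eq_of_surjective (S := A) (R := IsLocalRing.ResidueField A)
      (M := IsLocalRing.ResidueField (Localization.AtPrime n)) IsLocalRing.residue_surjective]
  let e : (B ⧸ n) ≃+* IsLocalRing.ResidueField (Localization.AtPrime n) :=
    IsLocalization.AtPrime.equivQuotMaximalIdeal n (Localization.AtPrime n)
  let e' : (B ⧸ n) ≃ₐ[A] IsLocalRing.ResidueField (Localization.AtPrime n) :=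
    AlgEquiv.ofRingEquiv (f := e) (fun a => by
      change IsLocalization.AtPrime.equivQuotMaximalIdeal n (Localization.AtPrime n)
        (Ideal.Quotient.mk _ (algebraMap A B a)) = _
      rw [IsLocalization.AtPrime.equivQuotMaximalIdeal_apply_mk,
        ← IsScalarTower.algebraMap_apply A B (Localization.AtPrime n)]
      rfl)
  exact e'.toLinearEquiv.length_eq.symm

/-- Formula (4.8) of Voevodsky's "Cancellation theorem". Let `A` be a noetherian local domain of
Krull dimension 1 with fraction field `K` and residue field `k`, and let `B ⊇ A` be a module-finite
domain extension with fraction field `L`. For nonzero `g ∈ A`: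
`[L : K] · length_A (A/gA) = Σ_n [B/n : k] · length_{B_n} (B_n / g B_n)`, the sum running over the
maximal ideals `n` of `B`. -/
theorem degree_mul_length_eq_sum_residue_degree_mul_length
    (A : Type*) [CommRing A] [IsDomain A] [IsNoetherianRing A] [IsLocalRing A]
    (hdim : ringKrullDim A = 1)
    (B : Type*) [CommRing B] [IsDomain B] [Algebra A B] [Module.Finite A B]
    (hinj : Function.Injective (algebraMap A B))
    (K : Type*) [Field K] [Algebra A K] [IsFractionRing A K]
    (L : Type*) [Field L] [Algebra B L] [IsFractionRing B L]
    [Algebra A L] [IsScalarTower A B L]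
    [Algebra K L] [IsScalarTower A K L]
    (g : A) (hg : g ≠ 0) :
    (Module.finrank K L : ℕ∞) * moduleLength A (A ⧸ Ideal.span {g}) =
      ∑ᶠ n : MaximalSpectrum B,
        (letI : Algebra (IsLocalRing.ResidueField A) (B ⧸ n.asIdeal) :=
          Ideal.Quotient.algebraQuotientOfLEComap (by
            haveI : Algebra.IsIntegral A B := Algebra.IsIntegral.of_finite A B
            haveI : (Ideal.comap (algebraMap A B) n.asIdeal).IsMaximal :=
              Ideal.isMaximal_comap_of_isIntegral_of_isMaximal n.asIdeal
            exact (IsLocalRing.eq_maximalIdeal this).ge)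
         (Module.finrank (IsLocalRing.ResidueField A) (B ⧸ n.asIdeal) : ℕ∞)) *
          moduleLength (Localization.AtPrime n.asIdeal)
            (Localization.AtPrime n.asIdeal ⧸
              Ideal.span {algebraMap B (Localization.AtPrime n.asIdeal) (algebraMap A B g)}) := by
  have hK : Ring.KrullDimLE 1 A := by
    rw [Ring.KrullDimLE, Order.krullDimLE_iff]
    exact hdim.le
  haveI : Algebra.IsIntegral A B := Algebra.IsIntegral.of_finite A B
  have hmax (n : MaximalSpectrum B) :
      n.asIdeal.comap (algebraMap A B) = IsLocalRing.maximalIdeal A := by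
    haveI : (Ideal.comap (algebraMap A B) n.asIdeal).IsMaximal :=
      Ideal.isMaximal_comap_of_isIntegral_of_isMaximal n.asIdeal
    exact IsLocalRing.eq_maximalIdeal this
  have hfin : Finite (MaximalSpectrum B) := by
    have := (Algebra.QuasiFinite.finite_primesOver (S := B)
      (IsLocalRing.maximalIdeal A)).to_subtype
    refine Finite.of_injective (β := (IsLocalRing.maximalIdeal A).primesOver B)
      (fun n => ⟨n.asIdeal, n.isMaximal.isPrime, ⟨(hmax n).symm⟩⟩) fun n m h => ?_
    exact MaximalSpectrum.ext (congrArg Subtype.val h)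
  have hart : IsArtinianRing (B ⧸ Ideal.span {algebraMap A B g}) := by
    refine isArtinian_of_tower A (aux_finite_length g hg fun m => ?_)
    obtain ⟨m, rfl⟩ := Ideal.Quotient.mk_surjective m
    rw [Algebra.smul_def]
    change Ideal.Quotient.mk _ (algebraMap A B g) * Ideal.Quotient.mk _ m = 0
    rw [← map_mul, Ideal.Quotient.eq_zero_iff_mem]
    exact Ideal.mul_mem_right _ _ (Ideal.mem_span_singleton_self _)
  have hlen := aux_rank hinj g hg
  obtain ⟨e⟩ := aux_crt (Ideal.span {algebraMap A B g})
  simp only [moduleLength, ← Module.length_eq_height]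
  haveI := Fintype.ofFinite (MaximalSpectrum B)
  rw [IsFractionRing.finrank_eq A K B L, ← hlen, (e.restrictScalars A).length_eq,
    Module.length_pi_of_fintype, finsum_eq_sum_of_fintype]
  refine Finset.sum_congr rfl fun n _ => ?_
  rw [Ideal.map_span, Set.image_singleton]
  exact aux_local n.asIdeal (hmax n).ge _
end
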